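/- For every index i with 1 ≤ i ≤ L−1 and every (t,α) ∈ ℝ × ℝ^{L−1}, one has ∂Γ^0_{00}/∂x_i − ∂Γ^0_{i0}/∂x_0 = −2 p_i'(t) A(t,α) B(t) P(t) / (N(t) B(t) + A(t,α)²)², where P(t) = Σ_{m=1}^{L−1} p_m(t) p_m'(t). -/

import Mathlib

/-!
Formalization of results from "A geometric approach to equilibrium selection":
the metric, Christoffel symbols and curvature of the equilibrium manifold of a
two-consumer exchange economy with `L` goods, parametrized by
`Φ(t,α) = (p_1(t),…,p_{L−1}(t), α_1,…,α_{L−1}, w(t) − Σ_m p_m(t) α_m)`.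

Indices run over `Fin L`, where the index `0` corresponds to the coordinate
`x_0 = t` and an index `i ≠ 0` corresponds to the coordinate `x_i = α_i`
(the component `α 0` of `α : Fin L → ℝ` is never used, so `α` is just a copy
of `ℝ^{L−1}` together with an irrelevant extra coordinate).
-/

open Matrix BigOperators

noncomputable section

namespace EqSelection

variable {L : ℕ}

/-- `A(t,α) = w'(t) − Σ_{m=1}^{L−1} p_m'(t) α_m`. -/
def eqA [NeZero L] (p : Fin L → ℝ → ℝ) (w : ℝ → ℝ) (t : ℝ) (α : Fin L → ℝ) : ℝ :=
  deriv w t - ∑ m ∈ Finset.univ \ {0}, deriv (p m) t * α m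

/-- `A'(t,α) = w''(t) − Σ_{m=1}^{L−1} p_m''(t) α_m`. -/
def eqA' [NeZero L] (p : Fin L → ℝ → ℝ) (w : ℝ → ℝ) (t : ℝ) (α : Fin L → ℝ) : ℝ :=
  deriv (deriv w) t - ∑ m ∈ Finset.univ \ {0}, deriv (deriv (p m)) t * α m

/-- `B(t) = Σ_{m=1}^{L−1} (p_m'(t))²`. -/
def eqB [NeZero L] (p : Fin L → ℝ → ℝ) (t : ℝ) : ℝ :=
  ∑ m ∈ Finset.univ \ {0}, (deriv (p m) t) ^ 2

/-- `N(t) = 1 + Σ_{m=1}^{L−1} (p_m(t))²`. -/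
def eqN [NeZero L] (p : Fin L → ℝ → ℝ) (t : ℝ) : ℝ :=
  1 + ∑ m ∈ Finset.univ \ {0}, (p m t) ^ 2

/-- `C(t) = Σ_{m=1}^{L−1} p_m'(t) p_m''(t)`. -/
def eqC [NeZero L] (p : Fin L → ℝ → ℝ) (t : ℝ) : ℝ :=
  ∑ m ∈ Finset.univ \ {0}, deriv (p m) t * deriv (deriv (p m)) t

/-- `P(t) = Σ_{m=1}^{L−1} p_m(t) p_m'(t)`. -/
def eqP [NeZero L] (p : Fin L → ℝ → ℝ) (t : ℝ) : ℝ :=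
  ∑ m ∈ Finset.univ \ {0}, p m t * deriv (p m) t

/-- The induced metric matrix `g(t,α)`: `g_{00} = B + A²`, `g_{0i} = g_{i0} = −p_i A`,
`g_{ij} = p_i p_j + δ_{ij}` for `i, j ≠ 0`. -/
def gMat [NeZero L] (p : Fin L → ℝ → ℝ) (w : ℝ → ℝ) (t : ℝ) (α : Fin L → ℝ) :
    Matrix (Fin L) (Fin L) ℝ :=
  Matrix.of fun i j =>
    if i = 0 then
      if j = 0 then eqB p t + (eqA p w t α) ^ 2 else -(p j t) * eqA p w t α
    else
      if j = 0 then -(p i t) * eqA p w t α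
      else p i t * p j t + (if i = j then 1 else 0)

/-- Partial derivative with respect to the coordinate `x_k`, where `x_0 = t`
and `x_i = α_i` for `i ≠ 0`. -/
def pder [NeZero L] (k : Fin L) (f : ℝ → (Fin L → ℝ) → ℝ) (t : ℝ) (α : Fin L → ℝ) : ℝ :=
  if k = 0 then deriv (fun s => f s α) t
  else deriv (fun s => f t (Function.update α k s)) (α k)

/-- Christoffel symbol
`Γ^k_{ij} = (1/2) Σ_{h=0}^{L−1} g^{hk} (∂g_{jh}/∂x_i + ∂g_{hi}/∂x_j − ∂g_{ij}/∂x_h)`,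
written `christoffel p w i j k`.  (Here `g^{hk}` denotes the entries of the inverse
matrix of `g`, i.e. of `(gMat p w t α)⁻¹`.) -/
def christoffel [NeZero L] (p : Fin L → ℝ → ℝ) (w : ℝ → ℝ) (i j k : Fin L)
    (t : ℝ) (α : Fin L → ℝ) : ℝ :=
  (1 / 2) * ∑ h : Fin L,
    (gMat p w t α)⁻¹ h k *
      (pder i (fun t' α' => gMat p w t' α' j h) t α
        + pder j (fun t' α' => gMat p w t' α' h i) t α
        - pder h (fun t' α' => gMat p w t' α' i j) t α)

/-- Curvature coefficient
`R^s_{ijk} = Σ_{m} Γ^m_{ik} Γ^s_{jm} − Σ_{m} Γ^m_{jk} Γ^s_{im} + ∂Γ^s_{ik}/∂x_j − ∂Γ^s_{jk}/∂x_i`,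
written `curvR p w i j k s`. -/
def curvR [NeZero L] (p : Fin L → ℝ → ℝ) (w : ℝ → ℝ) (i j k s : Fin L)
    (t : ℝ) (α : Fin L → ℝ) : ℝ :=
  (∑ m : Fin L, christoffel p w i k m t α * christoffel p w j m s t α)
    - (∑ m : Fin L, christoffel p w j k m t α * christoffel p w i m s t α)
    + pder j (christoffel p w i k s) t α - pder i (christoffel p w j k s) t α

/-- The coordinate tangent vectors `Φ_i(t,α) ∈ ℝ^{2L−1}` of the parametrization
`Φ(t,α) = (p_1(t),…,p_{L−1}(t), α_1,…,α_{L−1}, w(t) − Σ_m p_m(t) α_m)`: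
`Φ_0 = (p_1',…,p_{L−1}', 0,…,0, A)`, and for `i ≠ 0` the vector `Φ_i` has entry `1`
in position `(L−1)+i` (1-indexed), entry `−p_i` in the last position and `0` elsewhere. -/
def PhiVec [NeZero L] (p : Fin L → ℝ → ℝ) (w : ℝ → ℝ) (i : Fin L)
    (t : ℝ) (α : Fin L → ℝ) : Fin (2 * L - 1) → ℝ :=
  fun j =>
    if i = 0 then
      if h : (j : ℕ) < L - 1 then deriv (p ⟨(j : ℕ) + 1, by omega⟩) t
      else if (j : ℕ) = 2 * L - 2 then eqA p w t α else 0
    else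
      if (j : ℕ) + 1 = (L - 1) + (i : ℕ) then 1
      else if (j : ℕ) = 2 * L - 2 then -(p i t) else 0

/-- The matrix `M(t,α)` of Statement 2: `M_{00} = N`, `M_{0i} = M_{i0} = p_i A`,
`M_{ii} = (N − p_i²) B + A²`, `M_{ij} = −p_i p_j B` for `i ≠ j`, `i, j ≠ 0`. -/
def invNumer [NeZero L] (p : Fin L → ℝ → ℝ) (w : ℝ → ℝ) (t : ℝ) (α : Fin L → ℝ) :
    Matrix (Fin L) (Fin L) ℝ :=
  Matrix.of fun i j =>
    if i = 0 then
      if j = 0 then eqN p t else p j t * eqA p w t α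
    else
      if j = 0 then p i t * eqA p w t α
      else if i = j then (eqN p t - (p i t) ^ 2) * eqB p t + (eqA p w t α) ^ 2
      else -(p i t * p j t * eqB p t)

/-- The full index sum splits off the coordinate `x_0`. -/
theorem sum_eq_zero_add_sum_sdiff [NeZero L] (f : Fin L → ℝ) :
    ∑ h, f h = f 0 + ∑ h ∈ Finset.univ \ {0}, f h :=
  Finset.sum_eq_add_sum_sdiff_singleton_of_mem (Finset.mem_univ 0) f

theorem gMat_zero_zero [NeZero L] (p : Fin L → ℝ → ℝ) (w : ℝ → ℝ) (t : ℝ) (α : Fin L → ℝ) :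
    gMat p w t α 0 0 = eqB p t + eqA p w t α ^ 2 := by
  simp [gMat]

theorem gMat_zero_of_ne [NeZero L] (p : Fin L → ℝ → ℝ) (w : ℝ → ℝ) (t : ℝ) (α : Fin L → ℝ)
    {j : Fin L} (hj : j ≠ 0) : gMat p w t α 0 j = -(p j t) * eqA p w t α := by
  simp [gMat, hj]

theorem gMat_of_ne_zero [NeZero L] (p : Fin L → ℝ → ℝ) (w : ℝ → ℝ) (t : ℝ) (α : Fin L → ℝ)
    {i : Fin L} (hi : i ≠ 0) : gMat p w t α i 0 = -(p i t) * eqA p w t α := by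
  simp [gMat, hi]

theorem gMat_of_ne_of_ne [NeZero L] (p : Fin L → ℝ → ℝ) (w : ℝ → ℝ) (t : ℝ) (α : Fin L → ℝ)
    {i j : Fin L} (hi : i ≠ 0) (hj : j ≠ 0) :
    gMat p w t α i j = p i t * p j t + (if i = j then 1 else 0) := by
  simp [gMat, hi, hj]

/-- Off the first row and column, `invNumer` is a multiple of the identity plus a rank-one term. -/
theorem invNumer_of_ne_of_ne [NeZero L] (p : Fin L → ℝ → ℝ) (w : ℝ → ℝ) (t : ℝ) (α : Fin L → ℝ)
    {i j : Fin L} (hi : i ≠ 0) (hj : j ≠ 0) :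
    invNumer p w t α i j = (if i = j then eqN p t * eqB p t + eqA p w t α ^ 2 else 0)
      - p i t * p j t * eqB p t := by
  by_cases h : i = j
  · subst h
    simp [invNumer, hi]
    ring
  · simp [invNumer, hi, hj, h]

theorem sum_mul_self_eq_eqN_sub_one [NeZero L] (p : Fin L → ℝ → ℝ) (t : ℝ) :
    ∑ m ∈ Finset.univ \ {0}, p m t * p m t = eqN p t - 1 := by
  simp [eqN, sq]

theorem gMat_mul_invNumer [NeZero L] (p : Fin L → ℝ → ℝ) (w : ℝ → ℝ) (t : ℝ) (α : Fin L → ℝ) :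
    gMat p w t α * invNumer p w t α
      = (eqN p t * eqB p t + eqA p w t α ^ 2) • (1 : Matrix (Fin L) (Fin L) ℝ) := by
  have hN := sum_mul_self_eq_eqN_sub_one p t
  have h00 : invNumer p w t α 0 0 = eqN p t := by simp [invNumer]
  have h0j : ∀ j, j ≠ 0 → invNumer p w t α 0 j = p j t * eqA p w t α := by
    intro j hj
    simp [invNumer, hj]
  have hj0 : ∀ j, j ≠ 0 → invNumer p w t α j 0 = p j t * eqA p w t α := by
    intro j hj
    simp [invNumer, hj]
  ext i k
  rw [Matrix.mul_apply, sum_eq_zero_add_sum_sdiff, Matrix.smul_apply, Matrix.one_apply,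
    smul_eq_mul]
  by_cases hi : i = 0
  · subst hi
    by_cases hk : k = 0
    · subst hk
      have hsum : ∑ h ∈ Finset.univ \ {0}, gMat p w t α 0 h * invNumer p w t α h 0
          = -(eqA p w t α ^ 2) * ∑ m ∈ Finset.univ \ {0}, p m t * p m t := by
        rw [Finset.mul_sum]
        refine Finset.sum_congr rfl fun h hh => ?_
        have hh0 : h ≠ 0 := by simpa using hh
        rw [gMat_zero_of_ne p w t α hh0, hj0 h hh0]
        ring
      rw [hsum, hN, gMat_zero_zero, h00, if_pos rfl]
      ring
    · have hsum : ∑ h ∈ Finset.univ \ {0}, gMat p w t α 0 h * invNumer p w t α h k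
          = (eqA p w t α * p k t * eqB p t) * ∑ m ∈ Finset.univ \ {0}, p m t * p m t
            - p k t * eqA p w t α * (eqN p t * eqB p t + eqA p w t α ^ 2) := by
        have hk' : k ∈ Finset.univ \ {0} := by simp [hk]
        rw [Finset.mul_sum, ← Finset.sum_ite_eq_of_mem' (Finset.univ \ {0}) k
          (fun m => p m t * eqA p w t α * (eqN p t * eqB p t + eqA p w t α ^ 2)) hk',
          ← Finset.sum_sub_distrib]
        refine Finset.sum_congr rfl fun h hh => ?_
        have hh0 : h ≠ 0 := by simpa using hh
        rw [gMat_zero_of_ne p w t α hh0, invNumer_of_ne_of_ne p w t α hh0 hk]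
        split_ifs <;> ring
      rw [hsum, hN, gMat_zero_zero, h0j k hk, if_neg (Ne.symm hk)]
      ring
  · have hi' : i ∈ Finset.univ \ {0} := by simp [hi]
    by_cases hk : k = 0
    · subst hk
      have hsum : ∑ h ∈ Finset.univ \ {0}, gMat p w t α i h * invNumer p w t α h 0
          = (p i t * eqA p w t α) * ∑ m ∈ Finset.univ \ {0}, p m t * p m t
            + p i t * eqA p w t α := by
        rw [Finset.mul_sum]
        trans ∑ h ∈ Finset.univ \ {0}, (p i t * eqA p w t α * (p h t * p h t)
          + if i = h then p h t * eqA p w t α else 0)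
        swap
        · rw [Finset.sum_add_distrib, Finset.sum_ite_eq_of_mem _ i _ hi']
        refine Finset.sum_congr rfl fun h hh => ?_
        have hh0 : h ≠ 0 := by simpa using hh
        rw [gMat_of_ne_of_ne p w t α hi hh0, hj0 h hh0]
        split_ifs <;> ring
      rw [hsum, hN, gMat_of_ne_zero p w t α hi, h00, if_neg hi]
      ring
    · have hsum : ∑ h ∈ Finset.univ \ {0}, gMat p w t α i h * invNumer p w t α h k
          = -(p i t * p k t * eqB p t) * ∑ m ∈ Finset.univ \ {0}, p m t * p m t
            + p i t * p k t * (eqN p t * eqB p t + eqA p w t α ^ 2)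
            + ((if i = k then eqN p t * eqB p t + eqA p w t α ^ 2 else 0)
              - p i t * p k t * eqB p t) := by
        have hk' : k ∈ Finset.univ \ {0} := by simp [hk]
        rw [Finset.mul_sum, ← Finset.sum_ite_eq_of_mem (Finset.univ \ {0}) i
          (fun m => (if m = k then eqN p t * eqB p t + eqA p w t α ^ 2 else 0)
              - p m t * p k t * eqB p t) hi',
          ← Finset.sum_ite_eq_of_mem' (Finset.univ \ {0}) k
          (fun m => p i t * p m t * (eqN p t * eqB p t + eqA p w t α ^ 2)) hk',
          ← Finset.sum_add_distrib, ← Finset.sum_add_distrib]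
        refine Finset.sum_congr rfl fun h hh => ?_
        have hh0 : h ≠ 0 := by simpa using hh
        rw [gMat_of_ne_of_ne p w t α hi hh0, invNumer_of_ne_of_ne p w t α hh0 hk]
        split_ifs <;> ring
      rw [hsum, hN, gMat_of_ne_zero p w t α hi, h0j k hk]
      split_ifs <;> ring

theorem inv_gMat [NeZero L] (p : Fin L → ℝ → ℝ) (w : ℝ → ℝ) (t : ℝ) (α : Fin L → ℝ)
    (hD : eqN p t * eqB p t + eqA p w t α ^ 2 ≠ 0) :
    (gMat p w t α)⁻¹ = (eqN p t * eqB p t + eqA p w t α ^ 2)⁻¹ • invNumer p w t α := by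
  refine Matrix.inv_eq_right_inv ?_
  rw [Matrix.mul_smul, gMat_mul_invNumer, smul_smul, inv_mul_cancel₀ hD, one_smul]

/-- The determinant `N B + A²` of the metric is positive. -/
theorem eqN_mul_eqB_add_sq_pos [NeZero L] (p : Fin L → ℝ → ℝ) (w : ℝ → ℝ) (t : ℝ)
    (hreg : 0 < eqB p t ∨ deriv w t ≠ 0) (α : Fin L → ℝ) :
    0 < eqN p t * eqB p t + eqA p w t α ^ 2 := by
  have hN : 0 < eqN p t := by
    unfold eqN
    positivity
  have hB : 0 ≤ eqB p t := by
    unfold eqB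
    positivity
  rcases hB.lt_or_eq with hpos | hzero
  · positivity
  · have hp' : ∀ m ∈ Finset.univ \ {0}, deriv (p m) t = 0 := fun m hm =>
      pow_eq_zero_iff two_ne_zero |>.mp <|
        (Finset.sum_eq_zero_iff_of_nonneg fun m _ => sq_nonneg (deriv (p m) t)).mp hzero.symm m hm
    have hA : eqA p w t α = deriv w t := by
      rw [eqA, Finset.sum_eq_zero fun m hm => by rw [hp' m hm, zero_mul], sub_zero]
    have hw' : deriv w t ≠ 0 := hreg.resolve_left (by rw [← hzero]; exact lt_irrefl 0)
    rw [hA, ← hzero]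
    positivity

theorem hasDerivAt_deriv_of_contDiff {f : ℝ → ℝ} (hf : ContDiff ℝ (⊤ : ℕ∞) f) (t : ℝ) :
    HasDerivAt f (deriv f t) t :=
  (hf.differentiable (by simp) t).hasDerivAt

theorem contDiff_deriv {f : ℝ → ℝ} (hf : ContDiff ℝ (⊤ : ℕ∞) f) :
    ContDiff ℝ (⊤ : ℕ∞) (deriv f) :=
  (contDiff_infty_iff_deriv.mp hf).2

theorem hasDerivAt_eqA [NeZero L] {p : Fin L → ℝ → ℝ} {w : ℝ → ℝ}
    (hp : ∀ i, ContDiff ℝ (⊤ : ℕ∞) (p i)) (hw : ContDiff ℝ (⊤ : ℕ∞) w) (t : ℝ)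
    (α : Fin L → ℝ) : HasDerivAt (fun s => eqA p w s α) (eqA' p w t α) t :=
  (hasDerivAt_deriv_of_contDiff (contDiff_deriv hw) t).sub <| HasDerivAt.fun_sum fun m _ =>
    (hasDerivAt_deriv_of_contDiff (contDiff_deriv (hp m)) t).mul_const (α m)

theorem hasDerivAt_eqA_update [NeZero L] (p : Fin L → ℝ → ℝ) (w : ℝ → ℝ) (t : ℝ)
    (α : Fin L → ℝ) {i : Fin L} (hi : i ≠ 0) (x : ℝ) :
    HasDerivAt (fun s => eqA p w t (Function.update α i s)) (-deriv (p i) t) x := by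
  have hsum : HasDerivAt
      (fun s => ∑ m ∈ Finset.univ \ {0}, deriv (p m) t * Function.update α i s m)
      (∑ m ∈ Finset.univ \ {0}, deriv (p m) t * if m = i then 1 else 0) x := by
    refine HasDerivAt.fun_sum fun m _ => HasDerivAt.const_mul _ ?_
    by_cases hm : m = i
    · subst hm
      simpa using hasDerivAt_id' x
    · simpa [hm] using hasDerivAt_const x (α m)
  simpa [hi, eqA] using hsum.const_sub (deriv w t)

theorem hasDerivAt_eqA'_update [NeZero L] (p : Fin L → ℝ → ℝ) (w : ℝ → ℝ) (t : ℝ)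
    (α : Fin L → ℝ) {i : Fin L} (hi : i ≠ 0) (x : ℝ) :
    HasDerivAt (fun s => eqA' p w t (Function.update α i s)) (-deriv (deriv (p i)) t) x :=
  hasDerivAt_eqA_update (fun m => deriv (p m)) (deriv w) t α hi x

theorem hasDerivAt_eqN [NeZero L] {p : Fin L → ℝ → ℝ}
    (hp : ∀ i, ContDiff ℝ (⊤ : ℕ∞) (p i)) (t : ℝ) :
    HasDerivAt (eqN p) (2 * eqP p t) t := by
  have h : HasDerivAt (fun s => ∑ m ∈ Finset.univ \ {0}, p m s ^ 2)
      (∑ m ∈ Finset.univ \ {0}, 2 * (p m t * deriv (p m) t)) t := by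
    refine HasDerivAt.fun_sum fun m _ => ?_
    refine ((hasDerivAt_deriv_of_contDiff (hp m) t).fun_pow 2).congr_deriv ?_
    push_cast
    ring
  rw [← Finset.mul_sum] at h
  exact h.const_add 1

theorem hasDerivAt_eqB [NeZero L] {p : Fin L → ℝ → ℝ}
    (hp : ∀ i, ContDiff ℝ (⊤ : ℕ∞) (p i)) (t : ℝ) :
    HasDerivAt (eqB p) (2 * eqC p t) t := by
  have h : eqB p = fun s => eqN (fun m => deriv (p m)) s - 1 :=
    funext fun s => (add_sub_cancel_left 1 (eqB p s)).symm
  rw [h]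
  exact (hasDerivAt_eqN (fun m => contDiff_deriv (hp m)) t).sub_const 1

theorem pder_zero_eq [NeZero L] {f : ℝ → (Fin L → ℝ) → ℝ} {t : ℝ} {α : Fin L → ℝ} {f' : ℝ}
    (h : HasDerivAt (fun s => f s α) f' t) : pder 0 f t α = f' := by
  rw [pder, if_pos rfl, h.deriv]

theorem pder_of_ne_zero_eq [NeZero L] {f : ℝ → (Fin L → ℝ) → ℝ} {t : ℝ} {α : Fin L → ℝ} {f' : ℝ}
    {k : Fin L} (hk : k ≠ 0)
    (h : HasDerivAt (fun s => f t (Function.update α k s)) f' (α k)) : pder k f t α = f' := by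
  rw [pder, if_neg hk, h.deriv]

theorem pder_zero_gMat_zero_zero [NeZero L] {p : Fin L → ℝ → ℝ} {w : ℝ → ℝ}
    (hp : ∀ i, ContDiff ℝ (⊤ : ℕ∞) (p i)) (hw : ContDiff ℝ (⊤ : ℕ∞) w) (t : ℝ)
    (α : Fin L → ℝ) :
    pder 0 (fun t' α' => gMat p w t' α' 0 0) t α
      = 2 * eqC p t + 2 * eqA p w t α * eqA' p w t α := by
  refine pder_zero_eq ?_
  simp only [gMat_zero_zero]
  simpa using (hasDerivAt_eqB hp t).fun_add ((hasDerivAt_eqA hp hw t α).fun_pow 2)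

theorem pder_zero_neg_mul_eqA [NeZero L] {p : Fin L → ℝ → ℝ} {w : ℝ → ℝ}
    (hp : ∀ i, ContDiff ℝ (⊤ : ℕ∞) (p i)) (hw : ContDiff ℝ (⊤ : ℕ∞) w) (t : ℝ)
    (α : Fin L → ℝ) (j : Fin L) :
    pder 0 (fun t' α' => -(p j t') * eqA p w t' α') t α
      = -deriv (p j) t * eqA p w t α - p j t * eqA' p w t α := by
  refine pder_zero_eq ?_
  refine ((hasDerivAt_deriv_of_contDiff (hp j) t).fun_neg.fun_mul
    (hasDerivAt_eqA hp hw t α)).congr_deriv ?_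
  ring

theorem pder_zero_gMat_of_ne_of_ne [NeZero L] {p : Fin L → ℝ → ℝ}
    (hp : ∀ i, ContDiff ℝ (⊤ : ℕ∞) (p i)) (w : ℝ → ℝ) (t : ℝ)
    (α : Fin L → ℝ) {i j : Fin L} (hi : i ≠ 0) (hj : j ≠ 0) :
    pder 0 (fun t' α' => gMat p w t' α' i j) t α
      = deriv (p i) t * p j t + p i t * deriv (p j) t := by
  refine pder_zero_eq ?_
  simp only [gMat_of_ne_of_ne p w _ α hi hj]
  exact ((hasDerivAt_deriv_of_contDiff (hp i) t).fun_mul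
    (hasDerivAt_deriv_of_contDiff (hp j) t)).add_const _

theorem pder_of_ne_zero_gMat_zero_zero [NeZero L] (p : Fin L → ℝ → ℝ) (w : ℝ → ℝ) (t : ℝ)
    (α : Fin L → ℝ) {k : Fin L} (hk : k ≠ 0) :
    pder k (fun t' α' => gMat p w t' α' 0 0) t α = -2 * eqA p w t α * deriv (p k) t := by
  refine pder_of_ne_zero_eq hk ?_
  simp only [gMat_zero_zero]
  refine (((hasDerivAt_eqA_update p w t α hk (α k)).fun_pow 2).const_add (eqB p t)).congr_deriv ?_
  simp

theorem pder_of_ne_zero_neg_mul_eqA [NeZero L] (p : Fin L → ℝ → ℝ) (w : ℝ → ℝ) (t : ℝ)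
    (α : Fin L → ℝ) {k : Fin L} (hk : k ≠ 0) (j : Fin L) :
    pder k (fun t' α' => -(p j t') * eqA p w t' α') t α = p j t * deriv (p k) t := by
  refine pder_of_ne_zero_eq hk ?_
  simpa using (hasDerivAt_eqA_update p w t α hk (α k)).const_mul (-(p j t))

/-- The index-raising sum with upper index `0`, for covectors with `a_j = p_j c` for `j ≠ 0`. -/
theorem sum_inv_gMat_mul [NeZero L] (p : Fin L → ℝ → ℝ) (w : ℝ → ℝ) (t : ℝ) (α : Fin L → ℝ)
    (hD : eqN p t * eqB p t + eqA p w t α ^ 2 ≠ 0) (a : Fin L → ℝ) (c : ℝ)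
    (ha : ∀ j, j ≠ 0 → a j = p j t * c) :
    ∑ h, (gMat p w t α)⁻¹ h 0 * a h
      = (eqN p t * a 0 + (eqN p t - 1) * eqA p w t α * c)
        / (eqN p t * eqB p t + eqA p w t α ^ 2) := by
  have hsum : ∑ h ∈ Finset.univ \ {0}, invNumer p w t α h 0 * a h
      = (eqA p w t α * c) * ∑ m ∈ Finset.univ \ {0}, p m t * p m t := by
    rw [Finset.mul_sum]
    refine Finset.sum_congr rfl fun h hh => ?_
    have hh0 : h ≠ 0 := by simpa using hh
    rw [ha h hh0]
    simp only [invNumer, Matrix.of_apply, if_neg hh0, if_true]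
    ring
  have h00 : invNumer p w t α 0 0 = eqN p t := by simp [invNumer]
  simp only [inv_gMat p w t α hD, Matrix.smul_apply, smul_eq_mul, mul_assoc]
  rw [← Finset.mul_sum, sum_eq_zero_add_sum_sdiff, hsum, h00, sum_mul_self_eq_eqN_sub_one]
  ring

theorem christoffel_zero_zero_zero [NeZero L] {p : Fin L → ℝ → ℝ} {w : ℝ → ℝ}
    (hp : ∀ i, ContDiff ℝ (⊤ : ℕ∞) (p i)) (hw : ContDiff ℝ (⊤ : ℕ∞) w) (t : ℝ)
    (α : Fin L → ℝ) (hD : eqN p t * eqB p t + eqA p w t α ^ 2 ≠ 0) :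
    christoffel p w 0 0 0 t α
      = (eqN p t * eqC p t + eqA p w t α * eqA' p w t α)
        / (eqN p t * eqB p t + eqA p w t α ^ 2) := by
  rw [christoffel, sum_inv_gMat_mul p w t α hD _ (-2 * eqA' p w t α)]
  · rw [pder_zero_gMat_zero_zero hp hw]
    ring
  · intro j hj
    simp only [gMat_zero_of_ne p w _ _ hj, gMat_of_ne_zero p w _ _ hj]
    rw [pder_zero_neg_mul_eqA hp hw, pder_of_ne_zero_gMat_zero_zero p w t α hj]
    ring

theorem christoffel_of_ne_zero_zero_zero [NeZero L] {p : Fin L → ℝ → ℝ} {w : ℝ → ℝ}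
    (hp : ∀ i, ContDiff ℝ (⊤ : ℕ∞) (p i)) (t : ℝ)
    (α : Fin L → ℝ) (hD : eqN p t * eqB p t + eqA p w t α ^ 2 ≠ 0) {i : Fin L} (hi : i ≠ 0) :
    christoffel p w i 0 0 t α
      = -(eqA p w t α * deriv (p i) t) / (eqN p t * eqB p t + eqA p w t α ^ 2) := by
  rw [christoffel, sum_inv_gMat_mul p w t α hD _ (2 * deriv (p i) t)]
  · rw [pder_of_ne_zero_gMat_zero_zero p w t α hi]
    simp only [gMat_zero_of_ne p w _ _ hi, gMat_of_ne_zero p w _ _ hi]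
    ring
  · intro j hj
    rw [pder_zero_gMat_of_ne_of_ne hp w t α hj hi]
    simp only [gMat_zero_of_ne p w _ _ hj, gMat_of_ne_zero p w _ _ hi]
    rw [pder_of_ne_zero_neg_mul_eqA p w t α hi, pder_of_ne_zero_neg_mul_eqA p w t α hj]
    ring

theorem statement_11 (L : ℕ) [NeZero L] (hL : 2 ≤ L)
    (p : Fin L → ℝ → ℝ) (w : ℝ → ℝ)
    (hp : ∀ i, ContDiff ℝ (⊤ : ℕ∞) (p i)) (hw : ContDiff ℝ (⊤ : ℕ∞) w)
    (hreg : ∀ t : ℝ, 0 < eqB p t ∨ deriv w t ≠ 0) :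
    ∀ i : Fin L, i ≠ 0 →
      ∀ (t : ℝ) (α : Fin L → ℝ),
        pder i (christoffel p w 0 0 0) t α - pder 0 (christoffel p w i 0 0) t α
          = -2 * deriv (p i) t * eqA p w t α * eqB p t * eqP p t / (eqN p t * eqB p t + (eqA p w t α) ^ 2) ^ 2 := by
  intro i hi t α
  have hD : ∀ s β, eqN p s * eqB p s + eqA p w s β ^ 2 ≠ 0 := fun s β =>
    (eqN_mul_eqB_add_sq_pos p w s (hreg s) β).ne'
  have hA := hasDerivAt_eqA_update p w t α hi (α i)
  have hA' := hasDerivAt_eqA'_update p w t α hi (α i)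
  have hleft := ((hA.fun_mul hA').const_add (eqN p t * eqC p t)).fun_div
    ((hA.fun_pow 2).const_add (eqN p t * eqB p t)) (hD t _)
  have hAt := hasDerivAt_eqA hp hw t α
  have hright := (hAt.fun_mul
    (hasDerivAt_deriv_of_contDiff (contDiff_deriv (hp i)) t)).fun_neg.fun_div
    (((hasDerivAt_eqN hp t).fun_mul (hasDerivAt_eqB hp t)).fun_add (hAt.fun_pow 2)) (hD t α)
  have hΓ₀ : christoffel p w 0 0 0 = fun s β => (eqN p s * eqC p s + eqA p w s β * eqA' p w s β)
      / (eqN p s * eqB p s + eqA p w s β ^ 2) :=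
    funext₂ fun s β => christoffel_zero_zero_zero hp hw s β (hD s β)
  have hΓᵢ : christoffel p w i 0 0 = fun s β => -(eqA p w s β * deriv (p i) s)
      / (eqN p s * eqB p s + eqA p w s β ^ 2) :=
    funext₂ fun s β => christoffel_of_ne_zero_zero_zero hp s β (hD s β) hi
  rw [hΓ₀, hΓᵢ, pder_of_ne_zero_eq hi hleft, pder_zero_eq hright, Function.update_eq_self,
    ← sub_div]
  congr 1
  push_cast
  ring

end EqSelection
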